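/- Fix an integer K ≥ 2 and δ ∈ (0, 1/2]. For each n, let Pₙ be an edge-probability matrix on n nodes, and let 𝒞ₙ be the set of community assignments c : Fin n → Fin K such that at least two communities of c each contain at least δ·n nodes. Assume: (A1) n·p̄(Pₙ) → ∞ as n → ∞; (A3) min_{c ∈ 𝒞ₙ} n·p̄_in(c,Pₙ) → ∞ and min_{c ∈ 𝒞ₙ} n·p̄_out(c,Pₙ) → ∞. Let μₙ be the product Bernoulli measure under which the random graph A on n nodes has independent edges with A i j ~ Bernoulli(Pₙ i j) for i < j. Then for every ε > 0, μₙ( max_{c ∈ 𝒞ₙ} |T(c,A) − γ(c,Pₙ)| > ε ) → 0 as n → ∞; that is, the estimator T(·,A) converges to γ(·,Pₙ) in probability, uniformly over 𝒞ₙ. -/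

import Mathlib

open Finset

/-- The set of unordered pairs of distinct nodes, represented as ordered pairs `(i, j)`
with `i < j`. -/
def allPairs (n : ℕ) : Finset (Fin n × Fin n) :=
  Finset.univ.filter (fun p => p.1 < p.2)

/-- Intra-community pairs of the community assignment `c`. -/
def pairsIn {n K : ℕ} (c : Fin n → Fin K) : Finset (Fin n × Fin n) :=
  Finset.univ.filter (fun p => p.1 < p.2 ∧ c p.1 = c p.2)

/-- Inter-community pairs of the community assignment `c`. -/
def pairsOut {n K : ℕ} (c : Fin n → Fin K) : Finset (Fin n × Fin n) :=
  Finset.univ.filter (fun p => p.1 < p.2 ∧ c p.1 ≠ c p.2)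

/-- Arithmetic mean of `P i j` over a finite set of pairs. -/
noncomputable def meanOver {n : ℕ} (S : Finset (Fin n × Fin n))
    (P : Fin n → Fin n → ℝ) : ℝ :=
  (∑ p ∈ S, P p.1 p.2) / S.card

/-- `p̄(P)`: mean edge probability over all pairs of distinct nodes. -/
noncomputable def pbar {n : ℕ} (P : Fin n → Fin n → ℝ) : ℝ :=
  meanOver (allPairs n) P

/-- `p̄_in(c, P)`: mean edge probability over intra-community pairs. -/
noncomputable def pbarIn {n K : ℕ} (c : Fin n → Fin K) (P : Fin n → Fin n → ℝ) : ℝ :=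
  meanOver (pairsIn c) P

/-- `p̄_out(c, P)`: mean edge probability over inter-community pairs. -/
noncomputable def pbarOut {n K : ℕ} (c : Fin n → Fin K) (P : Fin n → Fin n → ℝ) : ℝ :=
  meanOver (pairsOut c) P

/-- The homophily parameter `γ(c, P)`. -/
noncomputable def gamma {n K : ℕ} (c : Fin n → Fin K) (P : Fin n → Fin n → ℝ) : ℝ :=
  (pbarIn c P - pbarOut c P) / pbar P

/-- An edge-probability matrix: symmetric, zero diagonal, entries in `[0,1]` off the
diagonal. -/
def IsEdgeProbMatrix {n : ℕ} (P : Fin n → Fin n → ℝ) : Prop :=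
  (∀ i j, P i j = P j i) ∧ (∀ i, P i i = 0) ∧
    (∀ i j, i ≠ j → 0 ≤ P i j ∧ P i j ≤ 1)

/-- A community assignment is admissible if some community contains at least two nodes
and at least two communities are nonempty. -/
def Admissible {n K : ℕ} (c : Fin n → Fin K) : Prop :=
  (∃ i j : Fin n, i ≠ j ∧ c i = c j) ∧ (∃ i j : Fin n, c i ≠ c j)

/-- A configuration of edge indicators, one Boolean per unordered pair `{i,j}` (encoded
as ordered pairs with `i < j`). -/
abbrev EdgeConfig (n : ℕ) := {p : Fin n × Fin n // p.1 < p.2} → Bool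

/-- The (symmetric, zero-diagonal) adjacency function of an edge configuration, taking
values `0` or `1` in `ℝ`. -/
def adj {n : ℕ} (f : EdgeConfig n) (i j : Fin n) : ℝ :=
  if h : i < j then (if f ⟨(i, j), h⟩ then 1 else 0)
  else if h' : j < i then (if f ⟨(j, i), h'⟩ then 1 else 0)
  else 0

/-- The product Bernoulli weight of an edge configuration under the edge-probability
matrix `P`: independent edges with `A i j ~ Bernoulli (P i j)` for `i < j`. -/
noncomputable def wt {n : ℕ} (P : Fin n → Fin n → ℝ) (f : EdgeConfig n) : ℝ :=
  ∏ e : {p : Fin n × Fin n // p.1 < p.2},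
    (if f e then P e.1.1 e.1.2 else 1 - P e.1.1 e.1.2)

open Classical in
/-- Probability of an event under the product Bernoulli random graph measure with edge
probabilities `P`. -/
noncomputable def graphProb {n : ℕ} (P : Fin n → Fin n → ℝ)
    (E : EdgeConfig n → Prop) : ℝ :=
  ∑ f ∈ Finset.univ.filter E, wt P f

/-- The test statistic `T(c, A)`, obtained by plugging the empirical means
`p̂_in, p̂_out, p̂` into the homophily formula; since `pbarIn`, `pbarOut` and `pbar`
are plain means, `T(c, A) = γ(c, adj f)` computed on the adjacency function. -/
noncomputable def Tstat {n K : ℕ} (c : Fin n → Fin K) (f : EdgeConfig n) : ℝ :=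
  (pbarIn c (adj f) - pbarOut c (adj f)) / pbar (adj f)

/-- `c` has at least two communities each containing at least `δ·n` nodes. -/
def TwoBigComms {n K : ℕ} (δ : ℝ) (c : Fin n → Fin K) : Prop :=
  ∃ u v : Fin K, u ≠ v ∧
    δ * n ≤ (Finset.univ.filter (fun i => c i = u)).card ∧
    δ * n ≤ (Finset.univ.filter (fun i => c i = v)).card

theorem aux_wt_nonneg {n : ℕ} {P : Fin n → Fin n → ℝ} (hP : IsEdgeProbMatrix P)
    (f : EdgeConfig n) : 0 ≤ wt P f := by
  unfold wt
  refine Finset.prod_nonneg fun e _ => ?_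
  have h := hP.2.2 e.1.1 e.1.2 (ne_of_lt e.2)
  split_ifs <;> linarith

theorem aux_prob_nonneg {n : ℕ} {P : Fin n → Fin n → ℝ} (hP : IsEdgeProbMatrix P)
    (E : EdgeConfig n → Prop) : 0 ≤ graphProb P E :=
  Finset.sum_nonneg fun f _ => aux_wt_nonneg hP f

theorem aux_markov {n : ℕ} {P : Fin n → Fin n → ℝ} (hP : IsEdgeProbMatrix P)
    (E : EdgeConfig n → Prop) (g : EdgeConfig n → ℝ) (h0 : ∀ f, 0 ≤ g f)
    (h1 : ∀ f, E f → 1 ≤ g f) : graphProb P E ≤ ∑ f, wt P f * g f := by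
  classical
  unfold graphProb
  rw [Finset.sum_filter]
  refine Finset.sum_le_sum fun f _ => ?_
  have hw := aux_wt_nonneg hP f
  split_ifs with h
  · nlinarith [h1 f h]
  · exact mul_nonneg hw (h0 f)

theorem aux_prob_union {n : ℕ} {P : Fin n → Fin n → ℝ} (hP : IsEdgeProbMatrix P)
    {ι : Type*} (s : Finset ι) (E : ι → EdgeConfig n → Prop) (b : ℝ)
    (hb : ∀ i ∈ s, graphProb P (E i) ≤ b) (F : EdgeConfig n → Prop)
    (hF : ∀ f, F f → ∃ i ∈ s, E i f) :
    graphProb P F ≤ s.card * b := by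
  classical
  have h := aux_markov hP F (fun f => ∑ i ∈ s, if E i f then (1:ℝ) else 0)
    (fun f => Finset.sum_nonneg fun i _ => by split_ifs <;> norm_num)
    (fun f hf => by
      obtain ⟨i, hi, hE⟩ := hF f hf
      have := Finset.single_le_sum (f := fun i => if E i f then (1:ℝ) else 0)
        (fun j _ => by split_ifs <;> norm_num) hi
      simpa [hE] using this)
  refine h.trans ?_
  have : ∑ f, wt P f * (∑ i ∈ s, if E i f then (1:ℝ) else 0) = ∑ i ∈ s, graphProb P (E i) := by
    simp_rw [Finset.mul_sum]
    rw [Finset.sum_comm]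
    refine Finset.sum_congr rfl fun i _ => ?_
    unfold graphProb
    rw [Finset.sum_filter]
    refine Finset.sum_congr rfl fun f _ => ?_
    split_ifs <;> simp
  rw [this]
  calc _ ≤ ∑ i ∈ s, b := Finset.sum_le_sum hb
    _ = _ := by simp

theorem aux_sum_sub {n : ℕ} (S : Finset (Fin n × Fin n)) (hS : S ⊆ allPairs n)
    (g : Fin n × Fin n → ℝ) :
    ∑ p ∈ S, g p = ∑ e : {p : Fin n × Fin n // p.1 < p.2}, if e.1 ∈ S then g e.1 else 0 := by
  classical
  have h1 : ∑ p ∈ S, g p = ∑ p ∈ allPairs n, if p ∈ S then g p else 0 := by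
    rw [← Finset.sum_filter]
    congr 1
    ext p
    simp only [Finset.mem_filter]
    exact ⟨fun h => ⟨hS h, h⟩, fun h => h.2⟩
  rw [h1]
  exact Finset.sum_subtype (allPairs n) (fun p => by simp [allPairs])
    (fun p => if p ∈ S then g p else 0)

theorem aux_mgf {n : ℕ} {P : Fin n → Fin n → ℝ} (hP : IsEdgeProbMatrix P)
    (S : Finset (Fin n × Fin n)) (hS : S ⊆ allPairs n) (s : ℝ) :
    ∑ f, wt P f * Real.exp (s * ∑ p ∈ S, adj f p.1 p.2) ≤
      Real.exp ((Real.exp s - 1) * ∑ p ∈ S, P p.1 p.2) := by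
  classical
  have key : ∀ f : EdgeConfig n, wt P f * Real.exp (s * ∑ p ∈ S, adj f p.1 p.2) =
      ∏ e : {p : Fin n × Fin n // p.1 < p.2},
        ((fun (e : {p : Fin n × Fin n // p.1 < p.2}) (b : Bool) =>
          (if b then P e.1.1 e.1.2 else 1 - P e.1.1 e.1.2) *
          Real.exp (s * (if e.1 ∈ S then (if b then 1 else 0) else 0))) e (f e)) := by
    intro f
    rw [aux_sum_sub S hS (fun p => adj f p.1 p.2), Finset.mul_sum, Real.exp_sum, wt,
      ← Finset.prod_mul_distrib]
    refine Finset.prod_congr rfl fun e _ => ?_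
    have : adj f e.1.1 e.1.2 = if f e then 1 else 0 := by
      unfold adj
      rw [dif_pos e.2]
    simp only [this]
  have hps := Fintype.prod_sum (fun (e : {p : Fin n × Fin n // p.1 < p.2}) (b : Bool) =>
          (if b then P e.1.1 e.1.2 else 1 - P e.1.1 e.1.2) *
          Real.exp (s * (if e.1 ∈ S then (if b then 1 else 0) else 0)))
  refine le_of_eq_of_le ((Finset.sum_congr rfl (fun f _ => key f)).trans
    (Eq.trans ?_ hps.symm)) ?_
  · congr!
  rw [aux_sum_sub S hS (fun p => P p.1 p.2), Finset.mul_sum, Real.exp_sum]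
  refine Finset.prod_le_prod (fun e _ => ?_) (fun e _ => ?_)
  · have h := hP.2.2 e.1.1 e.1.2 (ne_of_lt e.2)
    refine Finset.sum_nonneg fun b _ => mul_nonneg ?_ (Real.exp_pos _).le
    split_ifs <;> linarith
  · have h := hP.2.2 e.1.1 e.1.2 (ne_of_lt e.2)
    rw [Fintype.sum_bool]
    by_cases he : e.1 ∈ S
    · simp only [he, if_true]
      have := Real.add_one_le_exp ((Real.exp s - 1) * P e.1.1 e.1.2)
      simp
      linarith
    · simp [he]

theorem aux_one {n : ℕ} {P : Fin n → Fin n → ℝ} (hP : IsEdgeProbMatrix P)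
    (S : Finset (Fin n × Fin n)) (hS : S ⊆ allPairs n) (s : ℝ) (hs : |s| ≤ 1) :
    ∑ f, wt P f * Real.exp (s * (∑ p ∈ S, adj f p.1 p.2 - ∑ p ∈ S, P p.1 p.2)
        - 2 * s ^ 2 * ∑ p ∈ allPairs n, P p.1 p.2) ≤
      Real.exp (- s ^ 2 * ∑ p ∈ allPairs n, P p.1 p.2) := by
  have hm := aux_mgf hP S hS s
  have hnn : ∀ p ∈ allPairs n, 0 ≤ P p.1 p.2 := fun p hp => by
    simp only [allPairs, Finset.mem_filter] at hp
    exact (hP.2.2 _ _ (ne_of_lt hp.2)).1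
  have hle : ∑ p ∈ S, P p.1 p.2 ≤ ∑ p ∈ allPairs n, P p.1 p.2 :=
    Finset.sum_le_sum_of_subset_of_nonneg hS fun p hp _ => hnn p hp
  have h0 : 0 ≤ ∑ p ∈ S, P p.1 p.2 := Finset.sum_nonneg fun p hp => hnn p (hS hp)
  set m := ∑ p ∈ S, P p.1 p.2
  set M := ∑ p ∈ allPairs n, P p.1 p.2
  have : ∀ f : EdgeConfig n, wt P f * Real.exp (s * (∑ p ∈ S, adj f p.1 p.2 - m) - 2 * s ^ 2 * M)
      = (wt P f * Real.exp (s * ∑ p ∈ S, adj f p.1 p.2)) * Real.exp (- s * m - 2 * s ^ 2 * M) := by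
    intro f
    rw [mul_assoc (wt P f), ← Real.exp_add]
    congr 2
    ring
  simp_rw [this]
  rw [← Finset.sum_mul]
  refine (mul_le_mul_of_nonneg_right hm (Real.exp_pos _).le).trans ?_
  rw [← Real.exp_add]
  apply Real.exp_le_exp.2
  have h2 := (abs_le.1 (Real.abs_exp_sub_one_sub_id_le hs)).2
  nlinarith [mul_le_mul_of_nonneg_right h2 h0, mul_le_mul_of_nonneg_left hle (sq_nonneg s)]

theorem aux_dev {n : ℕ} {P : Fin n → Fin n → ℝ} (hP : IsEdgeProbMatrix P)
    (S : Finset (Fin n × Fin n)) (hS : S ⊆ allPairs n) (s : ℝ) (hs0 : 0 ≤ s) (hs : s ≤ 1) :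
    graphProb P (fun f => 2 * s * ∑ p ∈ allPairs n, P p.1 p.2 <
        |∑ p ∈ S, adj f p.1 p.2 - ∑ p ∈ S, P p.1 p.2|) ≤
      2 * Real.exp (- s ^ 2 * ∑ p ∈ allPairs n, P p.1 p.2) := by
  have h1 := aux_one hP S hS s (by rw [abs_of_nonneg hs0]; exact hs)
  have h2 := aux_one hP S hS (-s) (by rw [abs_neg, abs_of_nonneg hs0]; exact hs)
  have h := aux_markov hP (fun f => 2 * s * ∑ p ∈ allPairs n, P p.1 p.2 <
        |∑ p ∈ S, adj f p.1 p.2 - ∑ p ∈ S, P p.1 p.2|)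
    (fun f => Real.exp (s * (∑ p ∈ S, adj f p.1 p.2 - ∑ p ∈ S, P p.1 p.2)
        - 2 * s ^ 2 * ∑ p ∈ allPairs n, P p.1 p.2) +
        Real.exp ((-s) * (∑ p ∈ S, adj f p.1 p.2 - ∑ p ∈ S, P p.1 p.2)
        - 2 * (-s) ^ 2 * ∑ p ∈ allPairs n, P p.1 p.2))
    (fun f => (add_pos (Real.exp_pos _) (Real.exp_pos _)).le)
    (fun f hf => by
      rcases lt_abs.1 hf with hf | hf
      · refine le_trans (Real.one_le_exp ?_) (le_add_of_nonneg_right (Real.exp_pos _).le)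
        nlinarith [mul_le_mul_of_nonneg_left hf.le hs0]
      · refine le_trans (Real.one_le_exp ?_) (le_add_of_nonneg_left (Real.exp_pos _).le)
        nlinarith [mul_le_mul_of_nonneg_left hf.le hs0])
  refine h.trans ?_
  simp_rw [mul_add, Finset.sum_add_distrib]
  rw [neg_sq] at h2
  simp only [neg_sq]
  linarith

theorem aux_card {n : ℕ} (S : Finset (Fin n × Fin n)) (A B : Finset (Fin n))
    (h : ∀ i ∈ A, ∀ j ∈ B, i ≠ j → (i, j) ∈ S ∨ (j, i) ∈ S) :
    (A.card : ℝ) * B.card ≤ 2 * S.card + n := by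
  classical
  have hsub : A ×ˢ B ⊆ (S ∪ S.image Prod.swap) ∪ (Finset.univ.image fun i : Fin n => (i, i)) := by
    rintro ⟨i, j⟩ hij
    rw [Finset.mem_product] at hij
    by_cases hne : i = j
    · subst hne; simp
    · rcases h i hij.1 j hij.2 hne with h | h
      · simp [h]
      · simp [h]
  have h1 := Finset.card_le_card hsub
  have h2 := Finset.card_union_le (S ∪ S.image Prod.swap)
    (Finset.univ.image fun i : Fin n => (i, i))
  have h3 := Finset.card_union_le S (S.image Prod.swap)
  have h4 : (S.image Prod.swap).card ≤ S.card := Finset.card_image_le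
  have h5 : (Finset.univ.image fun i : Fin n => (i, i)).card ≤ n := by
    simpa using Finset.card_image_le (s := (Finset.univ : Finset (Fin n))) (f := fun i => (i, i))
  rw [Finset.card_product] at h1
  have : A.card * B.card ≤ 2 * S.card + n := by omega
  exact_mod_cast this

theorem aux_in_sub {n K : ℕ} (c : Fin n → Fin K) : pairsIn c ⊆ allPairs n := by
  intro p hp
  simp only [pairsIn, allPairs, Finset.mem_filter] at *
  tauto

theorem aux_out_sub {n K : ℕ} (c : Fin n → Fin K) : pairsOut c ⊆ allPairs n := by
  intro p hp
  simp only [pairsOut, allPairs, Finset.mem_filter] at *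
  tauto

theorem aux_in_card {n K : ℕ} (c : Fin n → Fin K) (δ : ℝ) (h0 : 0 < δ) (h : TwoBigComms δ c) :
    δ ^ 2 * n ^ 2 ≤ 2 * (pairsIn c).card + n := by
  obtain ⟨u, v, huv, hu, hv⟩ := h
  have := aux_card (pairsIn c) (Finset.univ.filter (fun i => c i = u))
    (Finset.univ.filter (fun i => c i = u)) (by
      intro i hi j hj hne
      simp only [Finset.mem_filter, Finset.mem_univ, true_and, pairsIn] at *
      rcases lt_or_gt_of_ne hne with h | h
      · exact Or.inl ⟨h, hi.trans hj.symm⟩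
      · exact Or.inr ⟨h, hj.trans hi.symm⟩)
  have := mul_le_mul hu hu (by positivity) (by positivity)
  nlinarith

theorem aux_out_card {n K : ℕ} (c : Fin n → Fin K) (δ : ℝ) (h0 : 0 < δ) (h : TwoBigComms δ c) :
    δ ^ 2 * n ^ 2 ≤ 2 * (pairsOut c).card + n := by
  obtain ⟨u, v, huv, hu, hv⟩ := h
  have := aux_card (pairsOut c) (Finset.univ.filter (fun i => c i = u))
    (Finset.univ.filter (fun i => c i = v)) (by
      intro i hi j hj hne
      simp only [Finset.mem_filter, Finset.mem_univ, true_and, pairsOut] at *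
      rcases lt_or_gt_of_ne hne with h | h
      · exact Or.inl ⟨h, by rw [hi, hj]; exact huv⟩
      · exact Or.inr ⟨h, by rw [hi, hj]; exact huv.symm⟩)
  have := mul_le_mul hu hv (by positivity) (by positivity)
  nlinarith

theorem aux_all_card (n : ℕ) : (n : ℝ) ^ 2 ≤ 2 * (allPairs n).card + n := by
  have := aux_card (allPairs n) Finset.univ Finset.univ (by
      intro i hi j hj hne
      simp only [Finset.mem_filter, Finset.mem_univ, true_and, allPairs] at *
      exact lt_or_gt_of_ne hne)
  simp at this
  nlinarith

theorem aux_all_card_le (n : ℕ) : ((allPairs n).card : ℝ) ≤ (n : ℝ) ^ 2 := by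
  have : (allPairs n).card ≤ n * n := by
    simpa using Finset.card_le_univ (allPairs n)
  rw [sq]
  exact_mod_cast this

/-- Ratio estimate. -/
theorem aux_ratio (X Y m M k N C s : ℝ) (hM : 0 < M) (hk : 0 < k) (hN : 0 < N)
    (hNk : N ≤ C * k) (hs0 : 0 ≤ s) (hs : s ≤ 1 / 4) (hm0 : 0 ≤ m) (hm : m ≤ M)
    (h1 : |X - m| ≤ 2 * s * M) (h2 : |Y - M| ≤ 2 * s * M) :
    |(X / k) / (Y / N) - (m / k) / (M / N)| ≤ 8 * C * s := by
  have h2' := abs_le.1 h2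
  have hY : M / 2 ≤ Y := by nlinarith
  have hYp : 0 < Y := by linarith
  have e : (X / k) / (Y / N) - (m / k) / (M / N) = (N / k) * (((X - m) * M + m * (M - Y)) / (Y * M)) := by
    field_simp
    ring
  have hNk' : N / k ≤ C := by rwa [div_le_iff₀ hk]
  have hC : 0 ≤ C := le_trans (by positivity) hNk'
  rw [e, abs_mul, abs_of_pos (div_pos hN hk), abs_div, abs_of_pos (mul_pos hYp hM)]
  have hnum : |(X - m) * M + m * (M - Y)| ≤ 4 * s * M ^ 2 := by
    refine (abs_add_le _ _).trans ?_
    rw [abs_mul, abs_mul, abs_of_pos hM, abs_of_nonneg hm0, abs_sub_comm M Y]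
    have a1 := mul_le_mul_of_nonneg_right h1 hM.le
    have a2 := mul_le_mul hm h2 (abs_nonneg _) hM.le
    nlinarith
  have hq : |(X - m) * M + m * (M - Y)| / (Y * M) ≤ 8 * s := by
    rw [div_le_iff₀ (mul_pos hYp hM)]
    nlinarith [mul_le_mul_of_nonneg_left hY (mul_nonneg hs0 hM.le)]
  calc _ ≤ C * (8 * s) := mul_le_mul hNk' hq (by positivity) hC
    _ = _ := by ring

/-- Under the sparsity assumptions (A1) and (A3), the estimator
`T(·, A)` converges to `γ(·, Pₙ)` in probability, uniformly over the class `𝒞ₙ` of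
community assignments having two communities of size at least `δ·n`. -/
theorem uniform_convergence_of_estimator (K : ℕ) (hK : 2 ≤ K)
    (δ : ℝ) (hδ0 : 0 < δ) (hδ1 : δ ≤ 1 / 2)
    (P : ∀ n : ℕ, Fin n → Fin n → ℝ) (hP : ∀ n, IsEdgeProbMatrix (P n))
    (hA1 : Filter.Tendsto (fun n : ℕ => (n : ℝ) * pbar (P n))
      Filter.atTop Filter.atTop)
    (hA3in : ∀ M : ℝ, ∃ N : ℕ, ∀ n ≥ N, ∀ c : Fin n → Fin K,
      TwoBigComms δ c → M ≤ (n : ℝ) * pbarIn c (P n))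
    (hA3out : ∀ M : ℝ, ∃ N : ℕ, ∀ n ≥ N, ∀ c : Fin n → Fin K,
      TwoBigComms δ c → M ≤ (n : ℝ) * pbarOut c (P n))
    (ε : ℝ) (hε : 0 < ε) :
    Filter.Tendsto
      (fun n : ℕ => graphProb (P n)
        (fun f : EdgeConfig n => ∃ c : Fin n → Fin K, TwoBigComms δ c ∧
          ε < |Tstat c f - gamma c (P n)|))
      Filter.atTop (nhds 0) := by
  classical
  obtain ⟨C, hC⟩ : ∃ C : ℝ, C = 4 / δ ^ 2 := ⟨_, rfl⟩
  have hCpos : 0 < C := by rw [hC]; positivity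
  obtain ⟨s, hs⟩ : ∃ s : ℝ, s = min (1 / 4) (ε / (16 * C)) := ⟨_, rfl⟩
  have hspos : 0 < s := by rw [hs]; exact lt_min (by norm_num) (by positivity)
  have hs4 : s ≤ 1 / 4 := by rw [hs]; exact min_le_left _ _
  have hsε : 16 * C * s ≤ ε := by
    have : s ≤ ε / (16 * C) := by rw [hs]; exact min_le_right _ _
    rw [le_div_iff₀ (by positivity)] at this
    linarith
  have hKpos : (0:ℝ) < K := by exact_mod_cast (by omega : 0 < K)
  have hK1 : (1:ℝ) ≤ K := by exact_mod_cast (by omega : 1 ≤ K)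
  have hlog : 0 ≤ Real.log K := Real.log_nonneg hK1
  obtain ⟨B, hB⟩ : ∃ B : ℝ, B = 4 * (Real.log K + 1) / s ^ 2 := ⟨_, rfl⟩
  have hBpos : 0 < B := by rw [hB]; positivity
  have hlim : Filter.Tendsto (fun n : ℕ => 6 * Real.exp (-(n:ℝ))) Filter.atTop (nhds 0) := by
    have h1 : Filter.Tendsto (fun n : ℕ => Real.exp (-(n:ℝ))) Filter.atTop (nhds 0) :=
      Real.tendsto_exp_neg_atTop_nhds_zero.comp tendsto_natCast_atTop_atTop
    simpa using h1.const_mul 6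
  refine squeeze_zero' (Filter.Eventually.of_forall fun n => aux_prob_nonneg (hP n) _) ?_ hlim
  filter_upwards [hA1.eventually_ge_atTop B, Filter.eventually_ge_atTop 2,
    (tendsto_natCast_atTop_atTop (R := ℝ)).eventually_ge_atTop (2 / δ ^ 2)] with n hnB hn2 hnδ
  have hn2' : (2:ℝ) ≤ n := by exact_mod_cast hn2
  rw [div_le_iff₀ (by positivity)] at hnδ
  obtain ⟨M, hM⟩ : ∃ M : ℝ, M = ∑ p ∈ allPairs n, P n p.1 p.2 := ⟨_, rfl⟩
  have hN1 := aux_all_card n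
  have hN2 := aux_all_card_le n
  have hN4 : (n:ℝ) ^ 2 / 4 ≤ (allPairs n).card := by nlinarith
  have hNpos : (0:ℝ) < (allPairs n).card := by
    have : (0:ℝ) < (n:ℝ) ^ 2 / 4 := by positivity
    linarith
  have hMp : M = (allPairs n).card * pbar (P n) := by
    rw [pbar, meanOver, ← hM]; field_simp
  have hMlow : n / 4 * B ≤ M := by
    have hp : 0 ≤ pbar (P n) := by
      by_contra h
      push Not at h
      nlinarith
    rw [hMp]
    have := mul_le_mul_of_nonneg_right hN4 hp
    nlinarith
  have hMpos : 0 < M := lt_of_lt_of_le (by positivity) hMlow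
  have hnn : ∀ p ∈ allPairs n, 0 ≤ P n p.1 p.2 := fun p hp => by
    simp only [allPairs, Finset.mem_filter] at hp
    exact ((hP n).2.2 _ _ (ne_of_lt hp.2)).1
  let 𝒮 : Finset (Finset (Fin n × Fin n)) :=
    (Finset.univ.image fun c : Fin n → Fin K => pairsIn c) ∪
      (Finset.univ.image fun c : Fin n → Fin K => pairsOut c) ∪ {allPairs n}
  have h𝒮 : (𝒮.card : ℝ) ≤ 3 * (K:ℝ) ^ n := by
    have h1 := Finset.card_union_le ((Finset.univ.image fun c : Fin n → Fin K => pairsIn c) ∪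
      (Finset.univ.image fun c : Fin n → Fin K => pairsOut c)) {allPairs n}
    have h2 := Finset.card_union_le (Finset.univ.image fun c : Fin n → Fin K => pairsIn c)
      (Finset.univ.image fun c : Fin n → Fin K => pairsOut c)
    have h3 : (Finset.univ.image fun c : Fin n → Fin K => pairsIn c).card ≤ K ^ n := by
      simpa using Finset.card_image_le (s := (Finset.univ : Finset (Fin n → Fin K)))
        (f := fun c => pairsIn c)
    have h4 : (Finset.univ.image fun c : Fin n → Fin K => pairsOut c).card ≤ K ^ n := by
      simpa using Finset.card_image_le (s := (Finset.univ : Finset (Fin n → Fin K)))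
        (f := fun c => pairsOut c)
    have h5 : 1 ≤ K ^ n := Nat.one_le_pow _ _ (by omega)
    rw [Finset.card_singleton] at h1
    have : 𝒮.card ≤ 3 * K ^ n := by
      change (_ ∪ _ ∪ _ : Finset _).card ≤ _
      omega
    exact_mod_cast this
  have hsub : ∀ S ∈ 𝒮, S ⊆ allPairs n := by
    intro S hS
    simp only [𝒮, Finset.mem_union, Finset.mem_image, Finset.mem_univ, true_and,
      Finset.mem_singleton] at hS
    rcases hS with (⟨c, rfl⟩ | ⟨c, rfl⟩) | rfl
    · exact aux_in_sub c
    · exact aux_out_sub c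
    · exact Finset.Subset.refl _
  have hU := aux_prob_union (hP n) 𝒮 (fun S f => 2 * s * ∑ p ∈ allPairs n, P n p.1 p.2 <
        |∑ p ∈ S, adj f p.1 p.2 - ∑ p ∈ S, P n p.1 p.2|) _
      (fun S hS => aux_dev (hP n) S (hsub S hS) s hspos.le (by linarith))
      (fun f : EdgeConfig n => ∃ c : Fin n → Fin K, TwoBigComms δ c ∧
          ε < |Tstat c f - gamma c (P n)|) (by
    rintro f ⟨c, hc, hlt⟩
    by_contra hcon
    push Not at hcon
    rw [← hM] at hcon
    have hin := hcon (pairsIn c) (by simp [𝒮])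
    have hout := hcon (pairsOut c) (by simp [𝒮])
    have hall := hcon (allPairs n) (by simp [𝒮])
    rw [← hM] at hall
    have hcard : ∀ k : ℝ, δ ^ 2 * n ^ 2 ≤ 2 * k + n → 0 < k ∧ ((allPairs n).card : ℝ) ≤ C * k := by
      intro k hk
      have hk4 : δ ^ 2 * n ^ 2 / 4 ≤ k := by nlinarith
      have : 0 < δ ^ 2 * (n:ℝ) ^ 2 / 4 := by positivity
      refine ⟨by linarith, hN2.trans ?_⟩
      rw [hC, div_mul_eq_mul_div, le_div_iff₀ (by positivity)]
      linarith
    have hsum : ∀ S ⊆ allPairs n, 0 ≤ ∑ p ∈ S, P n p.1 p.2 ∧ ∑ p ∈ S, P n p.1 p.2 ≤ M := by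
      intro S hS
      rw [hM]
      exact ⟨Finset.sum_nonneg fun p hp => hnn p (hS hp),
        Finset.sum_le_sum_of_subset_of_nonneg hS fun p hp _ => hnn p hp⟩
    obtain ⟨i1, i2⟩ := hcard _ (aux_in_card c δ hδ0 hc)
    obtain ⟨o1, o2⟩ := hcard _ (aux_out_card c δ hδ0 hc)
    have r1 := aux_ratio _ _ _ M _ _ C s hMpos i1 hNpos i2 hspos.le hs4
      (hsum _ (aux_in_sub c)).1 (hsum _ (aux_in_sub c)).2 hin hall
    have r2 := aux_ratio _ _ _ M _ _ C s hMpos o1 hNpos o2 hspos.le hs4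
      (hsum _ (aux_out_sub c)).1 (hsum _ (aux_out_sub c)).2 hout hall
    rw [abs_le] at r1 r2
    have : |Tstat c f - gamma c (P n)| ≤ ε := by
      rw [Tstat, gamma, sub_div, sub_div]
      simp only [pbarIn, pbarOut, pbar, meanOver]
      rw [← hM, abs_le]
      constructor <;> linarith [r1.1, r1.2, r2.1, r2.2]
    linarith)
  refine hU.trans ?_
  rw [← hM]
  have hexp : (K:ℝ) ^ n * Real.exp (- s ^ 2 * M) ≤ Real.exp (-(n:ℝ)) := by
    have : (K:ℝ) ^ n = Real.exp (n * Real.log K) := by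
      rw [Real.exp_nat_mul, Real.exp_log hKpos]
    rw [this, ← Real.exp_add]
    apply Real.exp_le_exp.2
    have h1 := mul_le_mul_of_nonneg_left hMlow (sq_nonneg s)
    have h2 : s ^ 2 * (n / 4 * B) = n * (Real.log K + 1) := by
      rw [hB]; field_simp
    rw [h2] at h1
    linarith
  have := mul_le_mul_of_nonneg_right h𝒮 (by positivity : 0 ≤ 2 * Real.exp (- s ^ 2 * M))
  linarith
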